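/- arXiv:1507.02324 — 9 statements merged into one kernel-verified Lean document; each statement's English description precedes it below -/
import Mathlib

section
/- The left annihilator of W(2), i.e. the set {x ∈ W(2) : x·y = 0 for all y ∈ W(2)}, equals the 4-dimensional subspace span_F{e₄, e₅ − 2e₁ − 3e₈, e₃ + e₆, e₃ + e₇}. -/
noncomputable section

variable (F : Type*) [Field F] [CharZero F]

abbrev V2 (F : Type*) [Field F] : Type _ := Fin 2 → F

abbrev WW (F : Type*) [Field F] : Type _ := V2 F →ₗ[F] V2 F →ₗ[F] V2 F

def vone : V2 F := ![1, 0]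

/-- The multiplication on the space of bilinear maps. -/
def wmul (A B : WW F) : WW F :=
  LinearMap.mk₂ F
    (fun x y => A (vone F) (B x y) - B (A (vone F) x) y - B x (A (vone F) y))
    (fun x x' y => by simp only [map_add, LinearMap.add_apply]; abel)
    (fun c x y => by simp only [map_smul, LinearMap.smul_apply, smul_sub])
    (fun x y y' => by simp only [map_add, LinearMap.add_apply]; abel)
    (fun c x y => by simp only [map_smul, LinearMap.smul_apply, smul_sub])

/-- α_{ij}^k -/
def alphaM (i j k : Fin 2) : WW F :=
  LinearMap.mk₂ F (fun x y => (x i * y j) • (Pi.single k (1 : F) : V2 F))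
    (fun x x' y => by simp [add_mul, add_smul])
    (fun c x y => by simp [smul_smul, mul_assoc])
    (fun x y y' => by simp [mul_add, add_smul])
    (fun c x y => by simp [smul_smul, mul_assoc, mul_left_comm])

/-- The basis e₁, …, e₈ of W(2) (indexed 0,…,7). -/
def bE : Fin 8 → WW F :=
  ![alphaM F 0 0 0 - alphaM F 0 1 1 - alphaM F 1 0 1,
    alphaM F 0 0 1,
    alphaM F 1 1 1 - alphaM F 0 1 0 - alphaM F 1 0 0,
    alphaM F 1 1 0,
    (2 : F) • alphaM F 0 0 0 + alphaM F 0 1 1 + alphaM F 1 0 1,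
    (2 : F) • alphaM F 1 1 1 + alphaM F 0 1 0 + alphaM F 1 0 0,
    alphaM F 0 1 0 - alphaM F 1 0 0,
    alphaM F 0 1 1 - alphaM F 1 0 1]


/-- The span appearing as the left annihilator. -/
def annSpan : Submodule F (WW F) :=
  Submodule.span F {bE F 3, bE F 4 - (2 : F) • bE F 0 - (3 : F) • bE F 7,
    bE F 2 + bE F 5, bE F 2 + bE F 6}

/-- Testing against the bilinear maps `(x, y) ↦ xₖ • y` shows that the left annihilator consists of
the maps vanishing when their first argument is `v₁`. -/
theorem forall_wmul_eq_zero_iff (F : Type*) [Field F] (A : WW F) :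
    (∀ B : WW F, wmul F A B = 0) ↔ A (vone F) = 0 := by
  refine ⟨fun h => ?_, fun h B => ?_⟩
  · refine LinearMap.ext fun x => funext fun k => ?_
    have hk := congrFun (LinearMap.congr_fun₂
      (h ((LinearMap.proj k : V2 F →ₗ[F] F).smulRight LinearMap.id)) x (Pi.single k 1)) k
    simpa [wmul] using hk
  · refine LinearMap.ext₂ fun x y => ?_
    simp [wmul, h]

theorem mem_annSpan_iff (F : Type*) [Field F] [CharZero F] (A : WW F) :
    A ∈ annSpan F ↔ A (vone F) = 0 := by
  constructor
  · suffices annSpan F ≤ LinearMap.ker (LinearMap.applyₗ (R := F) (M₂ := V2 F →ₗ[F] V2 F) (vone F))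
      from fun hA => this hA
    refine Submodule.span_le.2 ?_
    rintro _ (rfl | rfl | rfl | rfl) <;>
    · refine LinearMap.ext fun y => funext fun k => ?_
      fin_cases k <;> simp [bE, alphaM, vone] <;> ring
  · intro h
    have hA : A = A (Pi.single 1 1) (Pi.single 1 1) 0 • bE F 3
        + (A (Pi.single 1 1) (Pi.single 0 1) 1 / 6) •
          (bE F 4 - (2 : F) • bE F 0 - (3 : F) • bE F 7)
        + (A (Pi.single 1 1) (Pi.single 1 1) 1 / 3 + A (Pi.single 1 1) (Pi.single 0 1) 0 / 6) •
          (bE F 2 + bE F 5)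
        + (-A (Pi.single 1 1) (Pi.single 0 1) 0 / 2) • (bE F 2 + bE F 6) := by
      have hv : vone F = Pi.single 0 1 := by
        ext i; fin_cases i <;> simp [vone]
      rw [hv] at h
      refine (Pi.basisFun F (Fin 2)).ext fun i => (Pi.basisFun F (Fin 2)).ext fun j =>
        funext fun k => ?_
      fin_cases i <;> fin_cases j <;> fin_cases k <;> simp [bE, alphaM, h] <;> ring_nf <;> simp
    rw [hA]
    refine add_mem (add_mem (add_mem ?_ ?_) ?_) ?_ <;>
      exact Submodule.smul_mem _ _ (Submodule.subset_span (by simp))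

/-- The left annihilator of W(2) equals span{e₄, e₅ − 2e₁ − 3e₈, e₃ + e₆, e₃ + e₇}. -/
theorem statement0 :
    {x : WW F | ∀ y : WW F, wmul F x y = 0} = (annSpan F : Set (WW F)) := by
  ext A
  exact (forall_wmul_eq_zero_iff F A).trans (mem_annSpan_iff F A).symm

end
end

section
/- If I is a nontrivial right ideal of W₂, then I is contained in the subspace span_F{e₄, e₃ + e₆}. -/
noncomputable section

variable (F : Type*) [Field F] [CharZero F]

/-- W₂ = span{e₁, …, e₆}, the algebra of commutative multiplications on V₂. -/
def W2span : Submodule F (WW F) :=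
  Submodule.span F {bE F 0, bE F 1, bE F 2, bE F 3, bE F 4, bE F 5}

/-- The second standard basis vector. -/
def vtwo : V2 F := ![0, 1]

omit [CharZero F] in
theorem vone_zero : vone F 0 = 1 := rfl

omit [CharZero F] in
theorem vone_one : vone F 1 = 0 := rfl

omit [CharZero F] in
theorem vtwo_zero : vtwo F 0 = 0 := rfl

omit [CharZero F] in
theorem vtwo_one : vtwo F 1 = 1 := rfl

/-- The commutative multiplication with `v₁v₁ = p`, `v₁v₂ = v₂v₁ = q`, `v₂v₂ = r`. -/
def commMul (p q r : V2 F) : WW F :=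
  p 0 • alphaM F 0 0 0 + p 1 • alphaM F 0 0 1 + q 0 • (alphaM F 0 1 0 + alphaM F 1 0 0)
    + q 1 • (alphaM F 0 1 1 + alphaM F 1 0 1) + r 0 • alphaM F 1 1 0 + r 1 • alphaM F 1 1 1

omit [CharZero F] in
theorem commMul_apply (p q r x y : V2 F) :
    commMul F p q r x y = (x 0 * y 0) • p + (x 0 * y 1 + x 1 * y 0) • q + (x 1 * y 1) • r := by
  ext i
  fin_cases i <;> simp [commMul, alphaM] <;> ring

theorem commMul_mem_W2span (p q r : V2 F) : commMul F p q r ∈ W2span F := by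
  have h : commMul F p q r = ((p 0 - 2 * q 1) / 3) • bE F 0 + p 1 • bE F 1
      + ((r 1 - 2 * q 0) / 3) • bE F 2 + r 0 • bE F 3
      + ((p 0 + q 1) / 3) • bE F 4 + ((r 1 + q 0) / 3) • bE F 5 := by
    refine LinearMap.ext₂ fun x y => ?_
    rw [commMul_apply]
    ext i
    fin_cases i <;> simp [bE, alphaM] <;> ring
  have hb (i : Fin 8)
      (hi : bE F i ∈ ({bE F 0, bE F 1, bE F 2, bE F 3, bE F 4, bE F 5} : Set (WW F))) (c : F) :
      c • bE F i ∈ W2span F :=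
    Submodule.smul_mem _ c (Submodule.subset_span hi)
  rw [h]
  refine add_mem (add_mem (add_mem (add_mem (add_mem ?_ ?_) ?_) ?_) ?_) ?_ <;>
    exact hb _ (by simp) _

omit [CharZero F] in
theorem eq_smul_vone_add_smul_vtwo (x : V2 F) : x = x 0 • vone F + x 1 • vtwo F := by
  ext i
  fin_cases i <;> simp [vone, vtwo]

omit [CharZero F] in
theorem apply_vone (A : WW F) (x : V2 F) (i : Fin 2) :
    A (vone F) x i = x 0 * A (vone F) (vone F) i + x 1 * A (vone F) (vtwo F) i := by
  conv_lhs => rw [eq_smul_vone_add_smul_vtwo F x]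
  simp

theorem apply_comm_of_mem_W2span {A : WW F} (hA : A ∈ W2span F) (x y : V2 F) :
    A x y = A y x := by
  induction hA using Submodule.span_induction with
  | mem B hB =>
    simp only [Set.mem_insert_iff, Set.mem_singleton_iff] at hB
    rcases hB with rfl | rfl | rfl | rfl | rfl | rfl <;> ext i <;> fin_cases i <;>
      simp [bE, alphaM] <;> ring
  | zero => rfl
  | add B C _ _ hB hC => simp [hB, hC]
  | smul c B _ hB => simp [hB]

theorem eq_commMul_of_mem_W2span {A : WW F} (hA : A ∈ W2span F) :
    A = commMul F (A (vone F) (vone F)) (A (vone F) (vtwo F)) (A (vtwo F) (vtwo F)) := by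
  refine LinearMap.ext₂ fun x y => ?_
  rw [commMul_apply]
  conv_lhs => rw [eq_smul_vone_add_smul_vtwo F x, eq_smul_vone_add_smul_vtwo F y]
  simp only [map_add, map_smul, LinearMap.add_apply, LinearMap.smul_apply,
    apply_comm_of_mem_W2span F hA (vtwo F) (vone F)]
  module

omit [CharZero F] in
theorem wmul_commMul_vone_vone (A : WW F) (p q r : V2 F) (i : Fin 2) :
    wmul F A (commMul F p q r) (vone F) (vone F) i =
      p 0 * A (vone F) (vone F) i + p 1 * A (vone F) (vtwo F) i
        - 2 * (A (vone F) (vone F) 0 * p i + A (vone F) (vone F) 1 * q i) := by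
  simp only [wmul, LinearMap.mk₂_apply, Pi.sub_apply]
  rw [apply_vone]
  simp only [commMul_apply]
  simp [vone]
  ring

omit [CharZero F] in
theorem wmul_commMul_vone_vtwo (A : WW F) (p q r : V2 F) (i : Fin 2) :
    wmul F A (commMul F p q r) (vone F) (vtwo F) i =
      q 0 * A (vone F) (vone F) i + q 1 * A (vone F) (vtwo F) i
        - (A (vone F) (vone F) 0 * q i + A (vone F) (vone F) 1 * r i)
        - (A (vone F) (vtwo F) 0 * p i + A (vone F) (vtwo F) 1 * q i) := by
  simp only [wmul, LinearMap.mk₂_apply, Pi.sub_apply]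
  rw [apply_vone]
  simp only [commMul_apply]
  simp [vone, vtwo]

omit [CharZero F] in
theorem wmul_eq_neg_one_smul {A : WW F} (h₁ : A (vone F) (vone F) = vone F)
    (h₂ : A (vone F) (vtwo F) = vtwo F) (B : WW F) : wmul F A B = (-1 : F) • B := by
  have h (x : V2 F) : A (vone F) x = x := by
    conv_lhs => rw [eq_smul_vone_add_smul_vtwo F x]
    rw [map_add, map_smul, map_smul, h₁, h₂, ← eq_smul_vone_add_smul_vtwo]
  refine LinearMap.ext₂ fun x y => ?_
  simp [wmul, h]

section RightIdeal

variable {F} {I : Submodule F (WW F)} (hI : ∀ x ∈ I, ∀ y ∈ W2span F, wmul F x y ∈ I)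
include hI

theorem W2span_le_of_apply_ne_zero {A : WW F} (hA : A ∈ I)
    (hc : A (vone F) (vone F) 1 ≠ 0) : W2span F ≤ I := by
  set a := A (vone F) (vone F) 0 with ha
  set c := A (vone F) (vone F) 1 with hc'
  set d := A (vone F) (vtwo F) 1 with hd
  have hmem := hI A hA _ (commMul_mem_W2span F 0 ![-1 / (2 * c), 0]
    ![d / (2 * c ^ 2), -3 / (2 * c)])
  intro B hB
  have hAB := hI _ hmem B hB
  rw [wmul_eq_neg_one_smul] at hAB
  · have h := I.smul_mem (-1) hAB
    rwa [smul_smul, neg_mul_neg, one_mul, one_smul] at h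
  · ext i
    rw [wmul_commMul_vone_vone]
    fin_cases i <;> simp [vone_zero, vone_one, ← ha, ← hc'] <;> field_simp
  · ext i
    rw [wmul_commMul_vone_vtwo]
    fin_cases i <;> simp [vtwo_zero, vtwo_one, ← ha, ← hc', ← hd] <;> field_simp <;> ring

theorem W2span_le_of_apply_ne_two_mul {A : WW F} (hA : A ∈ I)
    (hd : A (vone F) (vtwo F) 1 ≠ 2 * A (vone F) (vone F) 0) : W2span F ≤ I := by
  by_cases hc : A (vone F) (vone F) 1 = 0
  · refine W2span_le_of_apply_ne_zero hI (hI A hA _ (commMul_mem_W2span F ![0, 1] 0 0)) ?_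
    rw [wmul_commMul_vone_vone]
    simpa [hc, sub_eq_zero] using hd
  · exact W2span_le_of_apply_ne_zero hI hA hc

theorem apply_vone_eq_zero_of_not_W2span_le (hle : ¬ W2span F ≤ I) {A : WW F} (hA : A ∈ I) :
    A (vone F) (vone F) = 0 ∧ A (vone F) (vtwo F) = 0 := by
  have hc {B : WW F} (hB : B ∈ I) : B (vone F) (vone F) 1 = 0 := by
    by_contra h
    exact hle (W2span_le_of_apply_ne_zero hI hB h)
  have hd {B : WW F} (hB : B ∈ I) :
      B (vone F) (vtwo F) 1 = 2 * B (vone F) (vone F) 0 := by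
    by_contra h
    exact hle (W2span_le_of_apply_ne_two_mul hI hB h)
  have hcA := hc hA
  have hdA := hd hA
  have ha : A (vone F) (vone F) 0 = 0 := by
    have h := hd (hI A hA _ (commMul_mem_W2span F 0 ![0, 1] 0))
    rw [wmul_commMul_vone_vone, wmul_commMul_vone_vtwo] at h
    simpa [hcA, hdA] using h
  have hb : A (vone F) (vtwo F) 0 = 0 := by
    have h := hd (hI A hA _ (commMul_mem_W2span F ![0, 1] 0 0))
    rw [wmul_commMul_vone_vone, wmul_commMul_vone_vtwo] at h
    simp [hcA, hdA, ha] at h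
    have h3 : (3 : F) * A (vone F) (vtwo F) 0 = 0 := by linear_combination -h
    simpa using h3
  constructor <;> ext i <;> fin_cases i <;> simp [ha, hb, hcA, hdA]

end RightIdeal

/-- Every nontrivial right ideal of W₂ is contained in span{e₄, e₃ + e₆}. -/
theorem statement3 (I : Submodule F (WW F)) (hle : I ≤ W2span F)
    (hI : ∀ x ∈ I, ∀ y ∈ W2span F, wmul F x y ∈ I)
    (h0 : I ≠ ⊥) (h1 : I ≠ W2span F) :
    I ≤ Submodule.span F {bE F 3, bE F 2 + bE F 5} := by
  intro A hA
  have hnle : ¬ W2span F ≤ I := fun h => h1 (le_antisymm hle h)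
  obtain ⟨hp, hq⟩ := apply_vone_eq_zero_of_not_W2span_le hI hnle hA
  have hA' : A = A (vtwo F) (vtwo F) 0 • bE F 3
      + (A (vtwo F) (vtwo F) 1 / 3) • (bE F 2 + bE F 5) := by
    conv_lhs => rw [eq_commMul_of_mem_W2span F (hle hA), hp, hq]
    refine LinearMap.ext₂ fun x y => ?_
    rw [commMul_apply]
    ext i
    fin_cases i <;> simp [bE, alphaM] <;> ring
  exact Submodule.mem_span_pair.mpr ⟨_, _, hA'.symm⟩

end
end

section
/- If I is a nontrivial left ideal of W₂, then I = span_F{e₁, e₂, e₃, e₄} or I = span_F{e₅, e₆}. -/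
noncomputable section

variable (F : Type*) [Field F] [CharZero F]

section Table

omit [CharZero F]

lemma wmul_add_right (A B C : WW F) : wmul F A (B + C) = wmul F A B + wmul F A C := by
  refine LinearMap.ext₂ fun x y => ?_
  simp only [wmul, LinearMap.mk₂_apply, LinearMap.add_apply, map_add]
  abel

lemma wmul_smul_right (c : F) (A B : WW F) : wmul F A (c • B) = c • wmul F A B := by
  refine LinearMap.ext₂ fun x y => ?_
  simp only [wmul, LinearMap.mk₂_apply, LinearMap.smul_apply, map_smul, smul_sub]

/-- Left multiplication by `e₁` is the weight operator. -/
lemma wmul_weight_table :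
    wmul F (bE F 0) (bE F 0) = (-1 : F) • bE F 0 ∧
    wmul F (bE F 0) (bE F 1) = (-3 : F) • bE F 1 ∧
    wmul F (bE F 0) (bE F 2) = bE F 2 ∧
    wmul F (bE F 0) (bE F 3) = (3 : F) • bE F 3 ∧
    wmul F (bE F 0) (bE F 4) = (-1 : F) • bE F 4 ∧
    wmul F (bE F 0) (bE F 5) = bE F 5 := by
  refine ⟨?_, ?_, ?_, ?_, ?_, ?_⟩ <;> refine LinearMap.ext₂ fun x y => ?_ <;> ext k <;>
    fin_cases k <;> simp [wmul, bE, alphaM, vone] <;> ring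

/-- Left multiplication by `e₂` is the lowering operator. -/
lemma wmul_lowering_table :
    wmul F (bE F 1) (bE F 0) = (3 : F) • bE F 1 ∧
    wmul F (bE F 1) (bE F 1) = 0 ∧
    wmul F (bE F 1) (bE F 2) = (2 : F) • bE F 0 ∧
    wmul F (bE F 1) (bE F 3) = bE F 2 ∧
    wmul F (bE F 1) (bE F 4) = 0 ∧
    wmul F (bE F 1) (bE F 5) = (-1 : F) • bE F 4 := by
  refine ⟨?_, ?_, ?_, ?_, ?_, ?_⟩ <;> refine LinearMap.ext₂ fun x y => ?_ <;> ext k <;>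
    fin_cases k <;> simp [wmul, bE, alphaM, vone] <;> ring

/-- Left multiplication by `e₃` is the raising operator, up to sign. -/
lemma wmul_raising_table :
    wmul F (bE F 2) (bE F 0) = (-2 : F) • bE F 2 ∧
    wmul F (bE F 2) (bE F 1) = (-1 : F) • bE F 0 ∧
    wmul F (bE F 2) (bE F 2) = (-3 : F) • bE F 3 ∧
    wmul F (bE F 2) (bE F 3) = 0 ∧
    wmul F (bE F 2) (bE F 4) = bE F 5 ∧
    wmul F (bE F 2) (bE F 5) = 0 := by
  refine ⟨?_, ?_, ?_, ?_, ?_, ?_⟩ <;> refine LinearMap.ext₂ fun x y => ?_ <;> ext k <;>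
    fin_cases k <;> simp [wmul, bE, alphaM, vone] <;> ring

lemma mem_W2span_iff (x : WW F) : x ∈ W2span F ↔ ∃ a b c d p q : F,
    x = (a • bE F 0 + b • bE F 1 + c • bE F 2 + d • bE F 3) + (p • bE F 4 + q • bE F 5) := by
  simp only [W2span, Submodule.mem_span_insert, Submodule.mem_span_singleton]
  constructor
  · rintro ⟨a, _, ⟨b, _, ⟨c, _, ⟨d, _, ⟨p, _, ⟨q, rfl⟩, rfl⟩, rfl⟩, rfl⟩, rfl⟩, rfl⟩
    exact ⟨a, b, c, d, p, q, by abel⟩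
  · rintro ⟨a, b, c, d, p, q, rfl⟩
    exact ⟨a, _, ⟨b, _, ⟨c, _, ⟨d, _, ⟨p, _, ⟨q, rfl⟩, rfl⟩, rfl⟩, rfl⟩, rfl⟩, by abel⟩

lemma bE_mem_W2span :
    bE F 0 ∈ W2span F ∧ bE F 1 ∈ W2span F ∧ bE F 2 ∈ W2span F := by
  refine ⟨?_, ?_, ?_⟩ <;> exact Submodule.subset_span (by simp)

end Table

section LeftIdeal

variable {F} {I : Submodule F (WW F)} (hI : ∀ x ∈ W2span F, ∀ y ∈ I, wmul F x y ∈ I)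
  {a b c d p q : F}

include hI

/-- The Casimir operator separates the two isotypic components of an element of `I`. -/
lemma component_mem
    (h : (a • bE F 0 + b • bE F 1 + c • bE F 2 + d • bE F 3) + (p • bE F 4 + q • bE F 5) ∈ I) :
    a • bE F 0 + b • bE F 1 + c • bE F 2 + d • bE F 3 ∈ I ∧ p • bE F 4 + q • bE F 5 ∈ I := by
  obtain ⟨m0, m1, m2⟩ := bE_mem_W2span F
  obtain ⟨t0, t1, t2, t3, t4, t5⟩ := wmul_weight_table F
  obtain ⟨l0, l1, l2, l3, l4, l5⟩ := wmul_lowering_table F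
  obtain ⟨r0, r1, r2, -, r4, -⟩ := wmul_raising_table F
  have hH := hI _ m0 _ h
  have hHH := hI _ m0 _ hH
  have hNY := hI _ m2 _ (hI _ m1 _ h)
  have hC := I.add_mem (I.add_mem hHH (I.smul_mem (-2 : F) hH)) (I.smul_mem (-4 : F) hNY)
  have hu := I.smul_mem (1 / 12 : F) (I.add_mem hC (I.smul_mem (-3 : F) h))
  have key : a • bE F 0 + b • bE F 1 + c • bE F 2 + d • bE F 3 ∈ I := by
    convert hu using 1
    simp only [wmul_add_right, wmul_smul_right, t0, t1, t2, t3, t4, t5,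
      l0, l1, l2, l3, l4, l5, r0, r1, r2, r4, smul_zero, add_zero, zero_add]
    module
  refine ⟨key, ?_⟩
  convert I.add_mem h (I.smul_mem (-1 : F) key) using 1
  module

lemma four_dim_component (h : a • bE F 0 + b • bE F 1 + c • bE F 2 + d • bE F 3 ∈ I)
    (hne : bE F 1 ∉ I) : a = 0 ∧ b = 0 ∧ c = 0 ∧ d = 0 := by
  obtain ⟨-, m1, -⟩ := bE_mem_W2span F
  obtain ⟨l0, l1, l2, l3, -, -⟩ := wmul_lowering_table F
  have hz : ∀ r : F, r • bE F 1 ∈ I → r = 0 := fun r hr => by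
    by_contra h0
    exact hne ((I.smul_mem_iff h0).1 hr)
  have h₁ := hI _ m1 _ h
  have h₂ := hI _ m1 _ h₁
  have h₃ := hI _ m1 _ h₂
  simp only [wmul_add_right, wmul_smul_right, l0, l1, l2, l3, smul_zero,
    add_zero, zero_add] at h₁ h₂ h₃
  have hd : d = 0 := by
    have := hz (d * 6) (by convert h₃ using 1; module)
    simpa using this
  subst hd
  have hc : c = 0 := by
    have := hz (c * 6) (by convert h₂ using 1; module)
    simpa using this
  subst hc
  have ha : a = 0 := by
    have := hz (a * 3) (by convert h₁ using 1; module)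
    simpa using this
  subst ha
  exact ⟨rfl, hz b (by simpa using h), rfl, rfl⟩

omit [CharZero F] in
lemma two_dim_component (h : p • bE F 4 + q • bE F 5 ∈ I) (hne : bE F 4 ∉ I) :
    p = 0 ∧ q = 0 := by
  obtain ⟨-, m1, -⟩ := bE_mem_W2span F
  obtain ⟨-, -, -, -, l4, l5⟩ := wmul_lowering_table F
  have hz : ∀ r : F, r • bE F 4 ∈ I → r = 0 := fun r hr => by
    by_contra h0
    exact hne ((I.smul_mem_iff h0).1 hr)
  have h₁ := hI _ m1 _ h
  simp only [wmul_add_right, wmul_smul_right, l4, l5, smul_zero, zero_add] at h₁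
  obtain rfl : q = 0 := by
    have := hz (q * -1) (by convert h₁ using 1; module)
    simpa using this
  exact ⟨hz p (by simpa using h), rfl⟩

lemma four_dim_le (h : bE F 1 ∈ I) :
    Submodule.span F {bE F 0, bE F 1, bE F 2, bE F 3} ≤ I := by
  obtain ⟨-, -, m2⟩ := bE_mem_W2span F
  obtain ⟨r0, r1, r2, -, -, -⟩ := wmul_raising_table F
  have h0 : bE F 0 ∈ I := by
    have := hI _ m2 _ h
    rwa [r1, I.smul_mem_iff (by simp)] at this
  have h2 : bE F 2 ∈ I := by
    have := hI _ m2 _ h0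
    rwa [r0, I.smul_mem_iff (by simp)] at this
  have h3 : bE F 3 ∈ I := by
    have := hI _ m2 _ h2
    rwa [r2, I.smul_mem_iff (by simp)] at this
  rw [Submodule.span_le]
  rintro _ (rfl | rfl | rfl | rfl) <;> assumption

omit [CharZero F] in
lemma two_dim_le (h : bE F 4 ∈ I) : Submodule.span F {bE F 4, bE F 5} ≤ I := by
  obtain ⟨-, -, m2⟩ := bE_mem_W2span F
  obtain ⟨-, -, -, -, r4, -⟩ := wmul_raising_table F
  have h5 : bE F 5 ∈ I := r4 ▸ hI _ m2 _ h
  rw [Submodule.span_le]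
  rintro _ (rfl | rfl) <;> assumption

end LeftIdeal

/-- Every nontrivial left ideal of W₂ is span{e₁, e₂, e₃, e₄} or span{e₅, e₆}. -/
theorem statement4 (I : Submodule F (WW F)) (hle : I ≤ W2span F)
    (hI : ∀ x ∈ W2span F, ∀ y ∈ I, wmul F x y ∈ I)
    (h0 : I ≠ ⊥) (h1 : I ≠ W2span F) :
    I = Submodule.span F {bE F 0, bE F 1, bE F 2, bE F 3} ∨
    I = Submodule.span F {bE F 4, bE F 5} := by
  have mem4 (a b c d : F) : a • bE F 0 + b • bE F 1 + c • bE F 2 + d • bE F 3 ∈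
      Submodule.span F {bE F 0, bE F 1, bE F 2, bE F 3} := by
    refine add_mem (add_mem (add_mem ?_ ?_) ?_) ?_ <;>
      exact Submodule.smul_mem _ _ (Submodule.subset_span (by simp))
  have mem2 (p q : F) : p • bE F 4 + q • bE F 5 ∈ Submodule.span F {bE F 4, bE F 5} := by
    refine add_mem ?_ ?_ <;> exact Submodule.smul_mem _ _ (Submodule.subset_span (by simp))
  by_cases h4 : bE F 1 ∈ I
  · have le4 := four_dim_le hI h4
    left
    refine le_antisymm (fun x hx => ?_) le4
    obtain ⟨a, b, c, d, p, q, rfl⟩ := (mem_W2span_iff F x).1 (hle hx)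
    have hne : bE F 4 ∉ I := fun h2 => h1 <| le_antisymm hle fun y hy => by
      obtain ⟨a, b, c, d, p, q, rfl⟩ := (mem_W2span_iff F y).1 hy
      exact I.add_mem (le4 (mem4 a b c d)) (two_dim_le hI h2 (mem2 p q))
    obtain ⟨rfl, rfl⟩ := two_dim_component hI (component_mem hI hx).2 hne
    simpa using mem4 a b c d
  · have le2 : I ≤ Submodule.span F {bE F 4, bE F 5} := fun x hx => by
      obtain ⟨a, b, c, d, p, q, rfl⟩ := (mem_W2span_iff F x).1 (hle hx)
      obtain ⟨rfl, rfl, rfl, rfl⟩ := four_dim_component hI (component_mem hI hx).1 h4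
      simpa using mem2 p q
    right
    refine le_antisymm le2 (two_dim_le hI ?_)
    by_contra h2
    refine h0 ((Submodule.eq_bot_iff I).2 fun x hx => ?_)
    obtain ⟨p, q, rfl⟩ := Submodule.mem_span_pair.1 (le2 hx)
    obtain ⟨rfl, rfl⟩ := two_dim_component hI hx h2
    simp

end
end

section
/- If I is a nontrivial right ideal of S₂, then I is contained in the one-dimensional subspace F·e₄. -/
noncomputable section

variable (F : Type*) [Field F] [CharZero F]

/-- S₂ = span{e₁, e₂, e₃, e₄}. -/
def S2span : Submodule F (WW F) :=
  Submodule.span F {bE F 0, bE F 1, bE F 2, bE F 3}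

/-- The element of `S₂` with coordinates `a, b, c, d` in the basis `e₁, e₂, e₃, e₄`. -/
def traceZeroComb (a b c d : F) : WW F :=
  a • bE F 0 + b • bE F 1 + c • bE F 2 + d • bE F 3

theorem mem_S2span_iff (x : WW F) : x ∈ S2span F ↔ ∃ a b c d, x = traceZeroComb F a b c d := by
  simp only [S2span, traceZeroComb, Submodule.mem_span_insert, Submodule.mem_span_singleton]
  constructor
  · rintro ⟨a, _, ⟨b, _, ⟨c, _, ⟨d, rfl⟩, rfl⟩, rfl⟩, rfl⟩
    exact ⟨a, b, c, d, by abel⟩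
  · rintro ⟨a, b, c, d, rfl⟩
    exact ⟨a, _, ⟨b, _, ⟨c, _, ⟨d, rfl⟩, rfl⟩, rfl⟩, by abel⟩

theorem wmul_traceZeroComb (a b c d p q r s : F) :
    wmul F (traceZeroComb F a b c d) (traceZeroComb F p q r s) =
      traceZeroComb F (-a * p - c * q + 2 * b * r) (3 * b * p - 3 * a * q)
        (-2 * c * p + a * r + b * s) (-3 * c * r + 3 * a * s) := by
  refine LinearMap.ext₂ fun x y => ?_
  ext k
  fin_cases k <;>
    simp [wmul, traceZeroComb, bE, alphaM, vone] <;> ring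

theorem smul_traceZeroComb (t a b c d : F) :
    t • traceZeroComb F a b c d = traceZeroComb F (t * a) (t * b) (t * c) (t * d) := by
  simp only [traceZeroComb, smul_add, smul_smul]

/-- A right ideal of `S₂` containing `e₁` is all of `S₂`. -/
theorem S2span_le_of_bE_zero_mem (I : Submodule F (WW F))
    (hI : ∀ x ∈ I, ∀ y ∈ S2span F, wmul F x y ∈ I) (h : traceZeroComb F 1 0 0 0 ∈ I) :
    S2span F ≤ I := by
  intro x hx
  obtain ⟨a, b, c, d, rfl⟩ := (mem_S2span_iff F x).1 hx
  have key := hI _ h _ ((mem_S2span_iff F _).2 ⟨-a, -b / 3, c, d / 3, rfl⟩)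
  rw [wmul_traceZeroComb] at key
  convert key using 2 <;> field_simp <;> ring

/-- In a proper right ideal of `S₂` the operator `A(v₁, ·)` of every element is singular. -/
theorem sq_sub_mul_eq_zero_of_mem (I : Submodule F (WW F))
    (hI : ∀ x ∈ I, ∀ y ∈ S2span F, wmul F x y ∈ I) (h1 : ¬ S2span F ≤ I)
    {a b c d : F} (h : traceZeroComb F a b c d ∈ I) : a ^ 2 - b * c = 0 := by
  by_contra hq
  refine h1 (S2span_le_of_bE_zero_mem F I hI ?_)
  have key := hI _ h _ ((mem_S2span_iff F _).2
    ⟨a * (a ^ 2 + b * c), b * (a ^ 2 + b * c), a * (2 * a * c), c * (2 * a * c), rfl⟩)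
  rw [wmul_traceZeroComb] at key
  have key' := I.smul_mem (-((a ^ 2 - b * c) ^ 2)⁻¹) key
  rw [smul_traceZeroComb] at key'
  convert key' using 2 <;> field_simp <;> ring

/-- Every nontrivial right ideal of S₂ is contained in F·e₄. -/
theorem statement5 (I : Submodule F (WW F)) (hle : I ≤ S2span F)
    (hI : ∀ x ∈ I, ∀ y ∈ S2span F, wmul F x y ∈ I)
    (h0 : I ≠ ⊥) (h1 : I ≠ S2span F) :
    I ≤ Submodule.span F {bE F 3} := by
  have hnle : ¬ S2span F ≤ I := fun h => h1 (le_antisymm hle h)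
  intro x hx
  obtain ⟨a, b, c, d, rfl⟩ := (mem_S2span_iff F x).1 (hle hx)
  have hq := sq_sub_mul_eq_zero_of_mem F I hI hnle hx
  have hmul (p q r s : F) := sq_sub_mul_eq_zero_of_mem F I hI hnle
    (wmul_traceZeroComb F a b c d p q r s ▸ hI _ hx _ ((mem_S2span_iff F _).2 ⟨p, q, r, s, rfl⟩))
  have ha : a = 0 := by
    have h : 7 * a ^ 2 = 0 := by linear_combination hmul 1 0 0 0 + 6 * hq
    simpa using h
  have hb : b = 0 := by
    have h : 4 * b ^ 2 = 0 := by linear_combination hmul 0 0 1 0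
    simpa using h
  have hc : c = 0 := by
    have h : c ^ 2 = 0 := by linear_combination hmul 0 1 0 0
    simpa using h
  subst ha hb hc
  exact Submodule.mem_span_singleton.2 ⟨d, by simp [traceZeroComb]⟩

end
end

section
/- The algebra S₂ has no nontrivial left ideals: if I is a linear subspace of S₂ with S₂·I ⊆ I, then I = 0 or I = S₂. -/
noncomputable section

variable (F : Type*) [Field F] [CharZero F]

/-- The element of `S2span F` with given coordinates in the basis e₁, e₂, e₃, e₄. -/
def S2comb (a b c d : F) : WW F := a • bE F 0 + b • bE F 1 + c • bE F 2 + d • bE F 3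

omit [CharZero F] in
theorem exists_eq_S2comb_of_mem_S2span {x : WW F} (hx : x ∈ S2span F) :
    ∃ a b c d : F, x = S2comb F a b c d := by
  simp only [S2span, Submodule.mem_span_insert, Submodule.mem_span_singleton] at hx
  obtain ⟨a, _, ⟨b, _, ⟨c, _, ⟨d, rfl⟩, rfl⟩, rfl⟩, rfl⟩ := hx
  exact ⟨a, b, c, d, by simp only [S2comb, add_assoc]⟩

set_option maxHeartbeats 800000 in
omit [CharZero F] in
/-- Left multiplication by e₃ raises weights. -/
theorem wmul_bE_two_S2comb (a b c d : F) :
    wmul F (bE F 2) (S2comb F a b c d) = S2comb F (-b) 0 (-2 * a) (-3 * c) := by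
  ext i j k
  fin_cases i <;> fin_cases j <;> fin_cases k <;>
    simp [wmul, S2comb, bE, alphaM, vone] <;> ring

set_option maxHeartbeats 800000 in
omit [CharZero F] in
/-- Left multiplication by e₂ lowers weights. -/
theorem wmul_bE_one_S2comb (a b c d : F) :
    wmul F (bE F 1) (S2comb F a b c d) = S2comb F (2 * c) (3 * a) d 0 := by
  ext i j k
  fin_cases i <;> fin_cases j <;> fin_cases k <;>
    simp [wmul, S2comb, bE, alphaM, vone] <;> ring

omit [CharZero F] in
theorem smul_S2comb (t a b c d : F) :
    t • S2comb F a b c d = S2comb F (t * a) (t * b) (t * c) (t * d) := by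
  simp only [S2comb, smul_add, smul_smul]

/-- A subspace containing e₄ and stable under left multiplication by e₂ contains S₂. -/
theorem S2span_le_of_bE_three_mem (I : Submodule F (WW F))
    (hlow : ∀ y ∈ I, wmul F (bE F 1) y ∈ I) (h : bE F 3 ∈ I) : S2span F ≤ I := by
  have h₄ : S2comb F 0 0 0 1 ∈ I := by simpa [S2comb] using h
  have h₃ := hlow _ h₄
  rw [wmul_bE_one_S2comb] at h₃
  have h₁ := hlow _ h₃
  rw [wmul_bE_one_S2comb] at h₁
  have h₂ := hlow _ h₁
  rw [wmul_bE_one_S2comb] at h₂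
  have h₁' := I.smul_mem (2⁻¹ : F) h₁
  have h₂' := I.smul_mem (6⁻¹ : F) h₂
  rw [smul_S2comb] at h₁' h₂'
  rw [S2span, Submodule.span_le]
  rintro x (rfl | rfl | rfl | rfl)
  · simpa [S2comb] using h₁'
  · have h6 : (6⁻¹ : F) * (3 * 2) = 1 := by norm_num
    simpa [S2comb, h6] using h₂'
  · simpa [S2comb] using h₃
  · exact h

/-- A nonzero subspace of S₂ stable under left multiplication by e₃ contains e₄. -/
theorem bE_three_mem_of_ne_bot (I : Submodule F (WW F)) (hle : I ≤ S2span F)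
    (hraise : ∀ y ∈ I, wmul F (bE F 2) y ∈ I) (hne : I ≠ ⊥) : bE F 3 ∈ I := by
  obtain ⟨y, hy, hy0⟩ := I.exists_mem_ne_zero_of_ne_bot hne
  obtain ⟨a, b, c, d, rfl⟩ := exists_eq_S2comb_of_mem_S2span F (hle hy)
  have of_smul : ∀ t : F, t ≠ 0 → S2comb F 0 0 0 t ∈ I → bE F 3 ∈ I := by
    intro t ht h
    rwa [S2comb, zero_smul, zero_smul, zero_smul, zero_add, zero_add, zero_add,
      I.smul_mem_iff ht] at h
  have hy₁ := hraise _ hy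
  rw [wmul_bE_two_S2comb] at hy₁
  have hy₂ := hraise _ hy₁
  rw [wmul_bE_two_S2comb] at hy₂
  have hy₃ := hraise _ hy₂
  rw [wmul_bE_two_S2comb] at hy₃
  by_cases hb : b = 0
  · subst hb
    by_cases ha : a = 0
    · subst ha
      by_cases hc : c = 0
      · subst hc
        by_cases hd : d = 0
        · subst hd
          simp [S2comb] at hy0
        · exact of_smul d hd hy
      · exact of_smul (-3 * c) (by simpa using hc) (by simpa using hy₁)
    · exact of_smul (-3 * (-2 * a)) (by simpa using ha) (by simpa using hy₂)
  · exact of_smul (-3 * (-2 * -b)) (by simpa using hb) (by simpa using hy₃)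

/-- S₂ has no nontrivial left ideals. -/
theorem statement6 (I : Submodule F (WW F)) (hle : I ≤ S2span F)
    (hI : ∀ x ∈ S2span F, ∀ y ∈ I, wmul F x y ∈ I) :
    I = ⊥ ∨ I = S2span F := by
  have mem : ∀ i ∈ ({1, 2} : Set (Fin 8)), bE F i ∈ S2span F := by
    rintro i (rfl | rfl) <;> exact Submodule.subset_span (by simp)
  refine or_iff_not_imp_left.mpr fun hne => le_antisymm hle ?_
  exact S2span_le_of_bE_three_mem F I (hI _ (mem 1 (by simp)))
    (bE_three_mem_of_ne_bot F I hle (hI _ (mem 2 (by simp))) hne)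

end
end

section
/- For every left ideal Y₁ of W(2) there exists a left ideal Y₂ of W(2) such that W(2) = Y₁ + Y₂ and Y₁ ∩ Y₂ = 0. -/
noncomputable section

variable (F : Type*) [Field F] [CharZero F]

variable {F}

/-- A left ideal of `W(2)`. -/
def IsLeftIdeal (Y : Submodule F (WW F)) : Prop := ∀ A : WW F, ∀ B ∈ Y, wmul F A B ∈ Y

/-- A left ideal that is contained in every left ideal meeting it nontrivially. -/
def IsMinimal (U : Submodule F (WW F)) : Prop :=
  ∀ N : Submodule F (WW F), IsLeftIdeal N → ∀ x ∈ N, x ∈ U → x ≠ 0 → U ≤ N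

omit [CharZero F] in
lemma wmul_apply (A B : WW F) (x y : V2 F) :
    wmul F A B x y = A (vone F) (B x y) - B (A (vone F) x) y - B x (A (vone F) y) := rfl

omit [CharZero F] in
lemma IsLeftIdeal.sup {Y Z : Submodule F (WW F)} (hY : IsLeftIdeal Y) (hZ : IsLeftIdeal Z) :
    IsLeftIdeal (Y ⊔ Z) := by
  intro A B hB
  obtain ⟨y, hy, z, hz, rfl⟩ := Submodule.mem_sup.1 hB
  have : wmul F A (y + z) = wmul F A y + wmul F A z := by
    refine LinearMap.ext₂ fun u v => ?_
    simp only [wmul_apply, LinearMap.add_apply, map_add]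
    abel
  exact this ▸ Submodule.add_mem_sup (hY A y hy) (hZ A z hz)

omit [CharZero F] in
/-- A partial complement of a left ideal can be enlarged so that the sum covers a given minimal
left ideal. -/
lemma exists_disjoint_extension {Y Z U : Submodule F (WW F)} (hY : IsLeftIdeal Y)
    (hZ : IsLeftIdeal Z) (hU : IsLeftIdeal U) (hmin : IsMinimal U) (hd : Disjoint Y Z) :
    ∃ Z', IsLeftIdeal Z' ∧ Disjoint Y Z' ∧ Z ≤ Z' ∧ U ≤ Y ⊔ Z' := by
  by_cases h : U ≤ Y ⊔ Z
  · exact ⟨Z, hZ, hd, le_rfl, h⟩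
  · refine ⟨Z ⊔ U, hZ.sup hU, ?_, le_sup_left, le_sup_right.trans le_sup_right⟩
    rw [Submodule.disjoint_def] at hd ⊢
    intro x hx hxZU
    obtain ⟨z, hz, u, hu, rfl⟩ := Submodule.mem_sup.1 hxZU
    have hu' : u ∈ Y ⊔ Z := by
      rw [show u = (z + u) + (-1 : F) • z by module]
      exact Submodule.add_mem_sup hx (Z.smul_mem _ hz)
    have hu0 : u = 0 := by
      by_contra hu0
      exact h (hmin _ (hY.sup hZ) u hu' hu hu0)
    rw [hu0, add_zero] at hx ⊢
    exact hd z hx hz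

omit [CharZero F] in
lemma ext_entries {A B : WW F}
    (h : ∀ i j k : Fin 2, A (Pi.single i 1) (Pi.single j 1) k =
      B (Pi.single i 1) (Pi.single j 1) k) :
    A = B := by
  ext i j k
  simpa using h i j k

omit [CharZero F] in
lemma exists_apply_vone (f : Module.End F (V2 F)) : ∃ A : WW F, A (vone F) = f :=
  ⟨LinearMap.toSpanSingleton F _ f ∘ₗ LinearMap.proj (R := F) (φ := fun _ : Fin 2 => F) 0,
    by simp [vone]⟩

/-- The bilinear map `(x, y) ↦ f x • y`. -/
def leftScale : (V2 F →ₗ[F] F) →ₗ[F] WW F where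
  toFun f := LinearMap.mk₂ F (fun x y => f x • y) (by simp [add_smul]) (by simp [smul_smul])
    (by simp) (by intros; simp [smul_smul, mul_comm])
  map_add' f g := by ext; simp; ring
  map_smul' c f := by ext; simp [mul_assoc]

/-- The bilinear map `(x, y) ↦ f y • x`. -/
def rightScale : (V2 F →ₗ[F] F) →ₗ[F] WW F where
  toFun f := LinearMap.mk₂ F (fun x y => f y • x) (by simp) (by intros; simp [smul_smul, mul_comm])
    (by simp [add_smul]) (by simp [smul_smul])
  map_add' f g := by ext; simp; ring
  map_smul' c f := by ext; simp [mul_assoc]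

omit [CharZero F] in
lemma wmul_leftScale (A : WW F) (f : V2 F →ₗ[F] F) :
    wmul F A (leftScale f) = leftScale (-(f ∘ₗ A (vone F))) := by
  refine LinearMap.ext₂ fun x y => ?_
  simp [wmul_apply, leftScale]

omit [CharZero F] in
lemma wmul_rightScale (A : WW F) (f : V2 F →ₗ[F] F) :
    wmul F A (rightScale f) = rightScale (-(f ∘ₗ A (vone F))) := by
  refine LinearMap.ext₂ fun x y => ?_
  simp [wmul_apply, rightScale]

omit [CharZero F] in
lemma isLeftIdeal_range (φ : (V2 F →ₗ[F] F) →ₗ[F] WW F)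
    (hφ : ∀ A f, wmul F A (φ f) = φ (-(f ∘ₗ A (vone F)))) :
    IsLeftIdeal (LinearMap.range φ) := by
  rintro A _ ⟨f, rfl⟩
  exact ⟨_, (hφ A f).symm⟩

omit [CharZero F] in
lemma isMinimal_range (φ : (V2 F →ₗ[F] F) →ₗ[F] WW F)
    (hφ : ∀ A f, wmul F A (φ f) = φ (-(f ∘ₗ A (vone F)))) : IsMinimal (LinearMap.range φ) := by
  rintro N hN _ hx ⟨f, rfl⟩ h0 _ ⟨g, rfl⟩
  have hf : f ≠ 0 := by rintro rfl; simp at h0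
  obtain ⟨v, hv⟩ : ∃ v, f v ≠ 0 := by
    by_contra! h
    exact hf (LinearMap.ext h)
  obtain ⟨A, hA⟩ := exists_apply_vone (LinearMap.toSpanSingleton F _ (-(f v)⁻¹ • v) ∘ₗ g)
  have : wmul F A (φ f) = φ g := by
    rw [hφ, hA]
    congr 1
    ext1 x
    ext
    simp [hv]
  exact this ▸ hN A _ hx

/-- The trace-free bilinear maps, in coordinates. -/
def traceFree (a b c d : F) : WW F :=
  a • bE F 3 + b • bE F 0 + c • bE F 2 + d • bE F 1

omit [CharZero F] in
lemma wmul_traceFree (A : WW F) (a b c d : F) :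
    wmul F A (traceFree a b c d) =
      let p := A (vone F) (Pi.single 0 1) 0
      let q := A (vone F) (Pi.single 0 1) 1
      let r := A (vone F) (Pi.single 1 1) 0
      let s := A (vone F) (Pi.single 1 1) 1
      traceFree (p * a - 2 * s * a + 3 * r * c) (r * d + 2 * q * c - p * b)
        (q * a + 2 * r * b - s * c) (s * d - 2 * p * d + 3 * q * b) := by
  have key : ∀ x, A (vone F) x = x 0 • A (vone F) (Pi.single 0 1) +
      x 1 • A (vone F) (Pi.single 1 1) := by
    intro x
    rw [← map_smul, ← map_smul, ← map_add]
    congr 1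
    ext i; fin_cases i <;> simp
  apply ext_entries
  intro i j k
  rw [wmul_apply, key (traceFree a b c d _ _)]
  fin_cases i <;> fin_cases j <;> fin_cases k <;>
    simp [traceFree, bE, alphaM] <;> ring

variable (F) in
/-- The space of trace-free bilinear maps. -/
def traceFreeSpace : Submodule F (WW F) where
  carrier := {B | ∃ a b c d, B = traceFree a b c d}
  zero_mem' := ⟨0, 0, 0, 0, by simp [traceFree]⟩
  add_mem' := by
    rintro _ _ ⟨a, b, c, d, rfl⟩ ⟨a', b', c', d', rfl⟩
    exact ⟨a + a', b + b', c + c', d + d', by simp only [traceFree]; module⟩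
  smul_mem' := by
    rintro t _ ⟨a, b, c, d, rfl⟩
    exact ⟨t * a, t * b, t * c, t * d, by simp only [traceFree]; module⟩

omit [CharZero F] in
lemma isLeftIdeal_traceFreeSpace : IsLeftIdeal (traceFreeSpace F) := by
  rintro A _ ⟨a, b, c, d, rfl⟩
  exact ⟨_, _, _, _, wmul_traceFree A a b c d⟩

omit [CharZero F] in
lemma wmul_raise (a b c d : F) :
    wmul F (alphaM F 0 1 0) (traceFree a b c d) = traceFree (3 * c) d (2 * b) 0 := by
  rw [wmul_traceFree]
  simp [alphaM, vone]

omit [CharZero F] in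
lemma wmul_lower (a b c d : F) :
    wmul F (alphaM F 0 0 1) (traceFree a b c d) = traceFree 0 (2 * c) a (3 * b) := by
  rw [wmul_traceFree]
  simp [alphaM, vone]

lemma highest_mem {N : Submodule F (WW F)} (hN : IsLeftIdeal N) (a b c d : F)
    (h : traceFree a b c d ∈ N) (h0 : traceFree a b c d ≠ 0) : traceFree 1 0 0 0 ∈ N := by
  have scale : ∀ t : F, t ≠ 0 → traceFree t 0 0 0 ∈ N → traceFree 1 0 0 0 ∈ N := by
    intro t ht hN
    simpa [traceFree, smul_smul, ht] using N.smul_mem t⁻¹ hN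
  have h1 := hN (alphaM F 0 1 0) _ h
  have h2 := hN (alphaM F 0 1 0) _ h1
  have h3 := hN (alphaM F 0 1 0) _ h2
  simp only [wmul_raise, mul_zero] at h1 h2 h3
  by_cases hd : d = 0
  · by_cases hb : b = 0
    · by_cases hc : c = 0
      · subst hd hb hc
        refine scale a ?_ h
        rintro rfl
        simp [traceFree] at h0
      · subst hd hb
        exact scale (3 * c) (by simp [hc]) (by simpa using h1)
    · subst hd
      exact scale (3 * (2 * b)) (by simp [hb]) (by simpa using h2)
  · exact scale _ (by simp [hd]) h3

lemma traceFree_mem {N : Submodule F (WW F)} (hN : IsLeftIdeal N) (h : traceFree 1 0 0 0 ∈ N)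
    (a b c d : F) : traceFree a b c d ∈ N := by
  have h1 := hN (alphaM F 0 0 1) _ h
  have h2 := hN (alphaM F 0 0 1) _ h1
  have h3 := hN (alphaM F 0 0 1) _ h2
  simp only [wmul_lower, mul_zero, mul_one] at h1 h2 h3
  have e : traceFree a b c d = a • traceFree 1 0 0 0 + c • traceFree 0 0 1 0 +
      (b / 2) • traceFree 0 2 0 0 + (d / 6) • traceFree 0 0 0 (3 * 2) := by
    simp only [traceFree]
    module
  rw [e]
  exact N.add_mem (N.add_mem (N.add_mem (N.smul_mem _ h) (N.smul_mem _ h1))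
    (N.smul_mem _ h2)) (N.smul_mem _ h3)

lemma isMinimal_traceFreeSpace : IsMinimal (traceFreeSpace F) := by
  rintro N hN _ hx ⟨a, b, c, d, rfl⟩ h0 _ ⟨a', b', c', d', rfl⟩
  exact traceFree_mem hN (highest_mem hN a b c d hx h0) _ _ _ _

lemma exists_decomposition (B : WW F) : ∃ (a b c d : F) (f g : V2 F →ₗ[F] F),
    B = traceFree a b c d + leftScale f + rightScale g := by
  let β (i j k : Fin 2) : F := B (Pi.single i 1) (Pi.single j 1) k
  let s (i : Fin 2) : F := β i 0 0 + β i 1 1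
  let t (i : Fin 2) : F := β 0 i 0 + β 1 i 1
  let u (i : Fin 2) : F := (2 * s i - t i) / 3
  let v (i : Fin 2) : F := (2 * t i - s i) / 3
  refine ⟨β 1 1 0, β 0 0 0 - u 0 - v 0, β 1 1 1 - u 1 - v 1, β 0 0 1,
    Fintype.linearCombination F u, Fintype.linearCombination F v, ?_⟩
  apply ext_entries
  intro i j k
  fin_cases i <;> fin_cases j <;> fin_cases k <;>
    simp [traceFree, bE, alphaM, leftScale, rightScale, u, v, s, t, β,
      Fintype.linearCombination_apply_single] <;> ring

lemma sup_eq_top :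
    traceFreeSpace F ⊔ LinearMap.range leftScale ⊔ LinearMap.range rightScale = ⊤ := by
  refine eq_top_iff.2 fun B _ => ?_
  obtain ⟨a, b, c, d, f, g, rfl⟩ := exists_decomposition B
  exact Submodule.add_mem_sup (Submodule.add_mem_sup ⟨a, b, c, d, rfl⟩ ⟨f, rfl⟩) ⟨g, rfl⟩

variable (F)

/-- Every left ideal of W(2) has a complementary left ideal. -/
theorem statement7 (Y1 : Submodule F (WW F))
    (hY1 : ∀ x : WW F, ∀ y ∈ Y1, wmul F x y ∈ Y1) :
    ∃ Y2 : Submodule F (WW F), (∀ x : WW F, ∀ y ∈ Y2, wmul F x y ∈ Y2) ∧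
      Y1 ⊔ Y2 = ⊤ ∧ Y1 ⊓ Y2 = ⊥ := by
  have h0 : IsLeftIdeal (⊥ : Submodule F (WW F)) := by
    rintro A B rfl
    refine (Submodule.mem_bot F).2 (LinearMap.ext₂ fun x y => ?_)
    simp [wmul_apply]
  obtain ⟨Z, hZ, hd, -, hle⟩ := exists_disjoint_extension hY1 h0 isLeftIdeal_traceFreeSpace
    isMinimal_traceFreeSpace disjoint_bot_right
  obtain ⟨Z', hZ', hd', hZZ', hle'⟩ := exists_disjoint_extension hY1 hZ
    (isLeftIdeal_range _ wmul_leftScale) (isMinimal_range _ wmul_leftScale) hd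
  obtain ⟨Z'', hZ'', hd'', hZZ'', hle''⟩ := exists_disjoint_extension hY1 hZ'
    (isLeftIdeal_range _ wmul_rightScale) (isMinimal_range _ wmul_rightScale) hd'
  refine ⟨Z'', hZ'', top_le_iff.1 ?_, hd''.eq_bot⟩
  rw [← sup_eq_top]
  exact sup_le (sup_le (hle.trans (sup_le_sup_left (hZZ'.trans hZZ'') _))
    (hle'.trans (sup_le_sup_left hZZ'' _))) hle''

end
end

section
/- Let V be a finite-dimensional vector space over F and let e ∈ V be a nonzero vector. Let GL(V,e) = {f ∈ GL(V) : f(e) = e}. Then the map Φ : GL(V,e) → Aut(W(V,e)) defined by (Φ(f)(A))(x,y) = f(A(f⁻¹(x), f⁻¹(y))) for f ∈ GL(V,e), A ∈ W(V,e), x,y ∈ V, is a well-defined injective group homomorphism into the group of algebra automorphisms of W(V,e). -/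
noncomputable section

variable (F : Type*) [Field F] [CharZero F]
variable (M : Type*) [AddCommGroup M] [Module F M]

/-- The space of bilinear maps (multiplications) on M. -/
abbrev Wb : Type _ := M →ₗ[F] M →ₗ[F] M

/-- The multiplication of the algebra W(V,e):
(A·B)(x,y) = A(e, B(x,y)) − B(A(e,x), y) − B(x, A(e,y)). -/
def wmulE (e : M) (A B : Wb F M) : Wb F M :=
  LinearMap.mk₂ F
    (fun x y => A e (B x y) - B (A e x) y - B x (A e y))
    (fun x x' y => by simp only [map_add, LinearMap.add_apply]; abel)
    (fun c x y => by simp only [map_smul, LinearMap.smul_apply, smul_sub])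
    (fun x y y' => by simp only [map_add, LinearMap.add_apply]; abel)
    (fun c x y => by simp only [map_smul, LinearMap.smul_apply, smul_sub])

/-- The group of algebra automorphisms of W(V,e). -/
def AutoW (e : M) : Type _ :=
  {g : Wb F M ≃ₗ[F] Wb F M // ∀ A B, g (wmulE F M e A B) = wmulE F M e (g A) (g B)}

instance (e : M) : Group (AutoW F M e) where
  one := ⟨LinearEquiv.refl F (Wb F M), fun _ _ => rfl⟩
  mul g h := ⟨h.1.trans g.1, fun A B => by
    simp only [LinearEquiv.trans_apply, h.2, g.2]⟩
  inv g := ⟨g.1.symm, fun A B => g.1.injective (by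
    rw [LinearEquiv.apply_symm_apply, g.2, LinearEquiv.apply_symm_apply,
      LinearEquiv.apply_symm_apply])⟩
  mul_assoc a b c := rfl
  one_mul a := Subtype.ext (LinearEquiv.trans_refl a.1)
  mul_one a := Subtype.ext (LinearEquiv.refl_trans a.1)
  inv_mul_cancel a := Subtype.ext (LinearEquiv.self_trans_symm a.1)

/-- GL(V,e), the subgroup of GL(V) of maps fixing e. -/
def GLfix (e : M) : Subgroup (M ≃ₗ[F] M) where
  carrier := {f | f e = e}
  one_mem' := rfl
  mul_mem' := by
    intro a b ha hb
    show a (b e) = e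
    rw [hb, ha]
  inv_mem' := by
    intro a ha
    show a.symm e = e
    rw [← ha, a.symm_apply_apply, ha]

/-- Transport of bilinear maps along a linear automorphism, `A ↦ f ∘ A ∘ (f⁻¹ × f⁻¹)`. -/
def bilinTransport {K N : Type*} [Field K] [AddCommGroup N] [Module K N] (f : N ≃ₗ[K] N) :
    Wb K N ≃ₗ[K] Wb K N :=
  f.arrowCongr (f.arrowCongr f)

theorem bilinTransport_apply {K N : Type*} [Field K] [AddCommGroup N] [Module K N]
    (f : N ≃ₗ[K] N) (A : Wb K N) (x y : N) :
    bilinTransport f A x y = f (A (f.symm x) (f.symm y)) := rfl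

theorem bilinTransport_wmulE {K N : Type*} [Field K] [AddCommGroup N] [Module K N]
    {e : N} {f : N ≃ₗ[K] N} (hf : f e = e) (A B : Wb K N) :
    bilinTransport f (wmulE K N e A B) =
      wmulE K N e (bilinTransport f A) (bilinTransport f B) := by
  have hs : f.symm e = e := by rw [LinearEquiv.symm_apply_eq, hf]
  ext x y
  simp [bilinTransport_apply, wmulE, hs]

/-- The action of `GL(V,e)` on `W(V,e)` by transport of bilinear maps. -/
def transportHom {K N : Type*} [Field K] [AddCommGroup N] [Module K N] (e : N) :
    GLfix K N e →* AutoW K N e where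
  toFun f := ⟨bilinTransport f.1, bilinTransport_wmulE f.2⟩
  map_one' := rfl
  map_mul' _ _ := rfl

theorem transportHom_injective {K N : Type*} [Field K] [AddCommGroup N] [Module K N]
    {e : N} (he : e ≠ 0) : Function.Injective (transportHom (K := K) e) := by
  obtain ⟨φ, hφ⟩ := Module.Projective.exists_dual_ne_zero K he
  have key (f : GLfix K N e) (v : N) :
      (transportHom e f).1 (φ.smulRight (φ.smulRight v)) e e = (φ e * φ e) • f.1 v := by
    have hs : f.1.symm e = e := by rw [LinearEquiv.symm_apply_eq]; exact f.2.symm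
    change bilinTransport f.1 _ e e = _
    simp [bilinTransport_apply, hs, mul_smul]
  intro f g hfg
  ext v
  refine smul_right_injective N (mul_ne_zero hφ hφ) ?_
  change (φ e * φ e) • f.1 v = (φ e * φ e) • g.1 v
  rw [← key, ← key, hfg]

/-- Φ : GL(V,e) → Aut(W(V,e)), Φ(f)(A)(x,y) = f(A(f⁻¹x, f⁻¹y)), is a well-defined
injective group homomorphism. -/
theorem statement10 [FiniteDimensional F M] (e : M) (he : e ≠ 0) :
    ∃ Φ : GLfix F M e →* AutoW F M e,
      Function.Injective ⇑Φ ∧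
      ∀ (f : GLfix F M e) (A : Wb F M) (x y : M),
        ((Φ f).1 A) x y
          = (f : M ≃ₗ[F] M) (A ((f : M ≃ₗ[F] M).symm x) ((f : M ≃ₗ[F] M).symm y)) := by
  exact ⟨transportHom e, transportHom_injective he, fun _ _ _ _ => rfl⟩

end
end

section
/- The homomorphism Φ : GL(V₂,v₁) → Aut(W(2)), (Φ(f)(A))(x,y) = f(A(f⁻¹(x), f⁻¹(y))), is bijective: every algebra automorphism of W(2) equals Φ(f) for exactly one f ∈ GL(V₂) with f(v₁) = v₁. -/
noncomputable section

variable (F : Type*) [Field F] [CharZero F]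

/-- The group of algebra automorphisms of W(2). -/
def AutW : Type _ :=
  {g : WW F ≃ₗ[F] WW F // ∀ A B, g (wmul F A B) = wmul F (g A) (g B)}

instance : Group (AutW F) where
  one := ⟨LinearEquiv.refl F (WW F), fun _ _ => rfl⟩
  mul g h := ⟨h.1.trans g.1, fun A B => by
    simp only [LinearEquiv.trans_apply, h.2, g.2]⟩
  inv g := ⟨g.1.symm, fun A B => g.1.injective (by
    rw [LinearEquiv.apply_symm_apply, g.2, LinearEquiv.apply_symm_apply,
      LinearEquiv.apply_symm_apply])⟩
  mul_assoc a b c := rfl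
  one_mul a := Subtype.ext (LinearEquiv.trans_refl a.1)
  mul_one a := Subtype.ext (LinearEquiv.refl_trans a.1)
  inv_mul_cancel a := Subtype.ext (LinearEquiv.self_trans_symm a.1)

/-- GL(V₂,v₁), the subgroup of GL(V₂) of maps fixing v₁. -/
def GLv1 : Subgroup (V2 F ≃ₗ[F] V2 F) where
  carrier := {f | f (vone F) = vone F}
  one_mem' := rfl
  mul_mem' := by
    intro a b ha hb
    show a (b (vone F)) = vone F
    rw [hb, ha]
  inv_mem' := by
    intro a ha
    show a.symm (vone F) = vone F
    rw [← ha, a.symm_apply_apply, ha]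

/-- The quadratic relations satisfied by an `𝔰𝔩₂`-triple of `2 × 2` matrices. -/
theorem sl2_triple_relations {K : Type*} [Field K] [CharZero K]
    (E G : Matrix (Fin 2) (Fin 2) K) (hE : E ≠ 0)
    (h₁ : (E * G - G * E) * E - E * (E * G - G * E) = (2 : K) • E)
    (h₂ : (E * G - G * E) * G - G * (E * G - G * E) = (-2 : K) • G) :
    E * E = 0 ∧ G * G = 0 ∧ E * G + G * E = 1 := by
  have tE : E 0 0 + E 1 1 = 0 := by
    have h := congrArg Matrix.trace h₁
    rw [Matrix.trace_sub, Matrix.trace_mul_comm, sub_self, Matrix.trace_smul,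
      Matrix.trace_fin_two, smul_eq_mul] at h
    simpa using h.symm
  have tG : G 0 0 + G 1 1 = 0 := by
    have h := congrArg Matrix.trace h₂
    rw [Matrix.trace_sub, Matrix.trace_mul_comm, sub_self, Matrix.trace_smul,
      Matrix.trace_fin_two, smul_eq_mul] at h
    simpa using h.symm
  have e11 : E 1 1 = -E 0 0 := by linear_combination tE
  have g11 : G 1 1 = -G 0 0 := by linear_combination tG
  have a00 := congrFun (congrFun h₁ 0) 0
  have a01 := congrFun (congrFun h₁ 0) 1
  have a10 := congrFun (congrFun h₁ 1) 0
  have b00 := congrFun (congrFun h₂ 0) 0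
  have b01 := congrFun (congrFun h₂ 0) 1
  have b10 := congrFun (congrFun h₂ 1) 0
  simp only [Matrix.sub_apply, Matrix.mul_apply, Fin.sum_univ_two, Matrix.smul_apply,
    smul_eq_mul, e11, g11] at a00 a01 a10 b00 b01 b10
  generalize ha : E 0 0 = a at *
  generalize hb : E 0 1 = b at *
  generalize hc : E 1 0 = c at *
  generalize hp : G 0 0 = p at *
  generalize hq : G 0 1 = q at *
  generalize hr : G 1 0 = r at *
  have dE : a * a + b * c = 0 := by
    linear_combination (-a / 2) * a00 + (-c / 4) * a01 + (-b / 4) * a10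
  have dG : p * p + q * r = 0 := by
    linear_combination (p / 2) * b00 + (r / 4) * b01 + (q / 4) * b10
  have hs : 2 * a * p + b * r + c * q = 1 := by
    by_contra hne
    have hne' : 2 * a * p + b * r + c * q - 1 ≠ 0 := sub_ne_zero.mpr hne
    have za : a = 0 := by
      apply (mul_eq_zero.mp (?_ : (2 * a * p + b * r + c * q - 1) * a = 0)).resolve_left hne'
      linear_combination (1 / 2) * a00 + 2 * p * dE
    have zb : b = 0 := by
      apply (mul_eq_zero.mp (?_ : (2 * a * p + b * r + c * q - 1) * b = 0)).resolve_left hne'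
      linear_combination (1 / 2) * a01 + 2 * q * dE
    have zc : c = 0 := by
      apply (mul_eq_zero.mp (?_ : (2 * a * p + b * r + c * q - 1) * c = 0)).resolve_left hne'
      linear_combination (1 / 2) * a10 + 2 * r * dE
    apply hE
    ext i j
    fin_cases i <;> fin_cases j <;> simp [*]
  refine ⟨?_, ?_, ?_⟩
  · ext i j
    fin_cases i <;> fin_cases j <;>
      simp only [Fin.zero_eta, Fin.mk_one, Matrix.mul_apply, Fin.sum_univ_two, Matrix.zero_apply,
        ha, hb, hc, e11] <;>
      first | linear_combination dE | ring
  · ext i j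
    fin_cases i <;> fin_cases j <;>
      simp only [Fin.zero_eta, Fin.mk_one, Matrix.mul_apply, Fin.sum_univ_two, Matrix.zero_apply,
        hp, hq, hr, g11] <;>
      first | linear_combination dG | ring
  · ext i j
    fin_cases i <;> fin_cases j <;>
      simp [Matrix.mul_apply, Fin.sum_univ_two, ha, hb, hc, e11, hp, hq, hr, g11] <;>
      first | linear_combination hs | ring

open Matrix in
/-- A unital injective Lie algebra endomorphism of `𝔤𝔩₂` is conjugation by an invertible map. -/
theorem exists_conj_of_lie_hom {K : Type*} [Field K] [CharZero K]
    (ψ : Matrix (Fin 2) (Fin 2) K →ₗ[K] Matrix (Fin 2) (Fin 2) K)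
    (hinj : Function.Injective ψ) (hone : ψ 1 = 1)
    (hlie : ∀ M N, ψ (M * N - N * M) = ψ M * ψ N - ψ N * ψ M) :
    ∃ h : (Fin 2 → K) ≃ₗ[K] (Fin 2 → K), ∀ M v, ψ M *ᵥ h v = h (M *ᵥ v) := by
  set E : Matrix (Fin 2) (Fin 2) K := !![0, 1; 0, 0] with hE
  set G : Matrix (Fin 2) (Fin 2) K := !![0, 0; 1, 0] with hG
  have hE0 : ψ E ≠ 0 := by
    rw [Ne, map_eq_zero_iff ψ hinj]
    intro h
    simpa [hE] using congrFun (congrFun h 0) 1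
  have r₁ : (E * G - G * E) * E - E * (E * G - G * E) = (2 : K) • E := by
    ext i j
    fin_cases i <;> fin_cases j <;> norm_num [hE, hG]
  have r₂ : (E * G - G * E) * G - G * (E * G - G * E) = (-2 : K) • G := by
    ext i j
    fin_cases i <;> fin_cases j <;> norm_num [hE, hG]
  obtain ⟨hEE, hGG, hEG⟩ := sl2_triple_relations (ψ E) (ψ G) hE0
    (by rw [← hlie, ← hlie, r₁, map_smul]) (by rw [← hlie, ← hlie, r₂, map_smul])
  have dec (M : Matrix (Fin 2) (Fin 2) K) : M = ((M 0 0 + M 1 1) / 2) • 1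
      + ((M 0 0 - M 1 1) / 2) • (E * G - G * E) + M 0 1 • E + M 1 0 • G := by
    ext i j
    fin_cases i <;> fin_cases j <;> simp [hE, hG] <;> ring
  obtain ⟨x, hx⟩ : ∃ x, ψ E *ᵥ x ≠ 0 := by
    by_contra! h
    exact hE0 (Matrix.mulVec_injective (by ext1 x; simpa using h x))
  set w := ψ E *ᵥ x with hw
  have ew : ψ E *ᵥ w = 0 := by rw [hw, mulVec_mulVec, hEE, zero_mulVec]
  set z := ψ G *ᵥ w with hz
  have gz : ψ G *ᵥ z = 0 := by rw [hz, mulVec_mulVec, hGG, zero_mulVec]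
  have ez : ψ E *ᵥ z = w := by
    have h := congrArg (· *ᵥ w) hEG
    simpa only [add_mulVec, ← mulVec_mulVec, ew, mulVec_zero, add_zero, one_mulVec] using h
  let T : (Fin 2 → K) →ₗ[K] (Fin 2 → K) :=
    (LinearMap.proj 0).smulRight w + (LinearMap.proj 1).smulRight z
  have hT (v : Fin 2 → K) : T v = v 0 • w + v 1 • z := rfl
  have Tinj : Function.Injective T := by
    rw [injective_iff_map_eq_zero]
    intro v hv
    rw [hT] at hv
    have h := congrArg (ψ E *ᵥ ·) hv
    simp only [mulVec_add, mulVec_smul, ew, ez, smul_zero, zero_add, mulVec_zero,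
      smul_eq_zero, or_iff_left hx] at h
    rw [h, zero_smul, add_zero, smul_eq_zero, or_iff_left hx] at hv
    ext i
    fin_cases i
    exacts [hv, h]
  refine ⟨LinearEquiv.ofInjectiveEndo T Tinj, fun M v => ?_⟩
  simp only [LinearEquiv.coe_ofInjectiveEndo, hT]
  conv_lhs => rw [dec M]
  simp only [map_add, map_smul, hone, hlie, add_mulVec, smul_mulVec, sub_mulVec, mulVec_add,
    mulVec_smul, ← mulVec_mulVec, ew, ez, gz, ← hz, one_mulVec, mulVec_zero]
  simp only [mulVec, dotProduct, Fin.sum_univ_two]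
  module

section

variable {F}

/-- The action of `Module.End F V₂` on bilinear maps, by derivations. -/
def endAct (a : Module.End F (V2 F)) (B : WW F) : WW F :=
  LinearMap.mk₂ F (fun x y => a (B x y) - B (a x) y - B x (a y))
    (fun x x' y => by simp only [map_add, LinearMap.add_apply]; abel)
    (fun c x y => by simp only [map_smul, LinearMap.smul_apply, smul_sub])
    (fun x y y' => by simp only [map_add]; abel)
    (fun c x y => by simp only [map_smul, smul_sub])

theorem endAct_apply (a : Module.End F (V2 F)) (B : WW F) (x y : V2 F) :
    endAct a B x y = a (B x y) - B (a x) y - B x (a y) := rfl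

theorem wmul_eq_endAct (A B : WW F) : wmul F A B = endAct (A (vone F)) B := rfl

theorem endAct_lie (a b : Module.End F (V2 F)) (B : WW F) :
    endAct (a * b - b * a) B = endAct a (endAct b B) - endAct b (endAct a B) := by
  refine LinearMap.ext₂ fun x y => ?_
  simp only [endAct_apply, LinearMap.sub_apply, Module.End.mul_apply, map_sub]
  abel

theorem endAct_one (B : WW F) : endAct 1 B = -B := by
  refine LinearMap.ext₂ fun x y => ?_
  simp [endAct_apply]

theorem endAct_sub (a b : Module.End F (V2 F)) (B : WW F) :
    endAct (a - b) B = endAct a B - endAct b B := by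
  refine LinearMap.ext₂ fun x y => ?_
  simp only [endAct_apply, LinearMap.sub_apply, map_sub]
  abel

/-- The action of `Module.End F V₂` on bilinear maps is faithful. -/
theorem endAct_injective : Function.Injective (endAct (F := F)) := by
  intro a b hab
  rw [← sub_eq_zero]
  have h0 (B : WW F) : endAct (a - b) B = 0 := by
    rw [endAct_sub, hab]
    exact sub_self (endAct b B)
  generalize a - b = c at h0
  have key (i : Fin 2) (z : V2 F) : c z = (2 * c (Pi.single i 1) i) • z := by
    have h := LinearMap.congr_fun₂
      (h0 ((LinearMap.proj i).smulRight ((LinearMap.proj i).smulRight z)))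
      (Pi.single i 1) (Pi.single i 1)
    simp only [endAct_apply, LinearMap.smulRight_apply, LinearMap.proj_apply, Pi.single_eq_same,
      LinearMap.smul_apply, one_smul, LinearMap.zero_apply] at h
    linear_combination (norm := module) h
  have hc (i : Fin 2) : c (Pi.single i 1) i = 0 := by
    have h := congrFun (key i (Pi.single i 1)) i
    simp only [Pi.smul_apply, Pi.single_eq_same, smul_eq_mul] at h
    linear_combination -h
  ext1 i
  ext1
  simp [key 0, hc 0]

/-- The linear automorphism of bilinear maps induced by a linear automorphism of `V₂`. -/
def conjWW (f : V2 F ≃ₗ[F] V2 F) : WW F ≃ₗ[F] WW F :=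
  LinearEquiv.arrowCongr f (LinearEquiv.arrowCongr f f)

theorem conjWW_apply (f : V2 F ≃ₗ[F] V2 F) (A : WW F) (x y : V2 F) :
    conjWW f A x y = f (A (f.symm x) (f.symm y)) := rfl

theorem map_vone_of_GLv1 (f : GLv1 F) : (f : V2 F ≃ₗ[F] V2 F) (vone F) = vone F := f.2

theorem symm_vone_of_GLv1 (f : GLv1 F) : (f : V2 F ≃ₗ[F] V2 F).symm (vone F) = vone F := by
  rw [LinearEquiv.symm_apply_eq, map_vone_of_GLv1]

theorem conjWW_wmul (f : GLv1 F) (A B : WW F) :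
    conjWW (f : V2 F ≃ₗ[F] V2 F) (wmul F A B) = wmul F (conjWW f A) (conjWW f B) := by
  refine LinearMap.ext₂ fun x y => ?_
  simp [wmul_eq_endAct, endAct_apply, conjWW_apply, symm_vone_of_GLv1]

variable (F) in
/-- The homomorphism from `GL(V₂,v₁)` to the automorphism group of `W(2)`. -/
def conjHom : GLv1 F →* AutW F where
  toFun f := ⟨conjWW f, conjWW_wmul f⟩
  map_one' := rfl
  map_mul' _ _ := rfl

theorem conjHom_injective : Function.Injective (conjHom F) := by
  rw [injective_iff_map_eq_one]
  intro f hf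
  ext1
  ext1 z
  have h := LinearMap.congr_fun₂ (LinearEquiv.congr_fun (congrArg Subtype.val hf)
    ((LinearMap.proj 0).smulRight ((LinearMap.proj 0).smulRight z))) (vone F) (vone F)
  change conjWW _ _ _ _ = _ at h
  rw [conjWW_apply, symm_vone_of_GLv1] at h
  change _ = ((LinearMap.proj 0).smulRight ((LinearMap.proj 0).smulRight z) : WW F)
    (vone F) (vone F) at h
  simpa [vone] using h

/-- A section of the map `A ↦ A(v₁, ·)`. -/
def constSection : Module.End F (V2 F) →ₗ[F] WW F :=
  LinearMap.smulRightₗ (LinearMap.proj 0)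

theorem constSection_apply (a : Module.End F (V2 F)) (x : V2 F) :
    constSection a x = x 0 • a := rfl

theorem constSection_vone (a : Module.End F (V2 F)) : constSection a (vone F) = a := by
  simp [constSection_apply, vone]

theorem AutW.map_endAct (g : AutW F) (A B : WW F) :
    g.1 (endAct (A (vone F)) B) = endAct (g.1 A (vone F)) (g.1 B) := g.2 A B

/-- The linear endomorphism of `Module.End F V₂` induced by an automorphism of `W(2)`. -/
def AutW.onEnd (g : AutW F) : Module.End F (V2 F) →ₗ[F] Module.End F (V2 F) :=
  LinearMap.applyₗ (vone F) ∘ₗ g.1.toLinearMap ∘ₗ constSection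

theorem AutW.map_endAct_onEnd (g : AutW F) (a : Module.End F (V2 F)) (B : WW F) :
    g.1 (endAct a B) = endAct (g.onEnd a) (g.1 B) := by
  conv_lhs => rw [← constSection_vone a]
  exact g.map_endAct _ B

theorem eq_of_endAct_aut_eq (g : AutW F) {a b : Module.End F (V2 F)}
    (h : ∀ B, endAct a (g.1 B) = endAct b (g.1 B)) : a = b :=
  endAct_injective (funext fun B => by simpa using h (g.1.symm B))

theorem AutW.apply_vone (g : AutW F) (A : WW F) : g.1 A (vone F) = g.onEnd (A (vone F)) :=
  eq_of_endAct_aut_eq g fun B => by rw [← g.map_endAct, g.map_endAct_onEnd]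

theorem AutW.onEnd_one (g : AutW F) : g.onEnd 1 = 1 :=
  eq_of_endAct_aut_eq g fun B => by
    rw [← g.map_endAct_onEnd, endAct_one, endAct_one]
    exact map_neg g.1 B

theorem AutW.onEnd_lie (g : AutW F) (a b : Module.End F (V2 F)) :
    g.onEnd (a * b - b * a) = g.onEnd a * g.onEnd b - g.onEnd b * g.onEnd a :=
  eq_of_endAct_aut_eq g fun B => by
    rw [← g.map_endAct_onEnd, endAct_lie, endAct_lie]
    simp only [← g.map_endAct_onEnd]
    exact map_sub g.1 _ _

theorem AutW.onEnd_injective (g : AutW F) : Function.Injective g.onEnd := by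
  intro a b hab
  refine endAct_injective (funext fun B => g.1.injective ?_)
  rw [g.map_endAct_onEnd, g.map_endAct_onEnd, hab]

theorem AutW.exists_onEnd_eq_conj (g : AutW F) :
    ∃ h : V2 F ≃ₗ[F] V2 F, ∀ a v, g.onEnd a (h v) = h (a v) := by
  let e : Matrix (Fin 2) (Fin 2) F ≃ₐ[F] Module.End F (V2 F) := Matrix.toLinAlgEquiv'
  obtain ⟨h, hh⟩ := exists_conj_of_lie_hom
    (e.symm.toLinearMap ∘ₗ g.onEnd ∘ₗ e.toLinearMap)
    (e.symm.injective.comp (g.onEnd_injective.comp e.injective))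
    (by simp [g.onEnd_one])
    (fun M N => by simp [g.onEnd_lie])
  refine ⟨h, fun a v => ?_⟩
  have h1 := hh (e.symm a) v
  rw [← Matrix.toLinAlgEquiv'_apply, ← Matrix.toLinAlgEquiv'_apply] at h1
  change e (e.symm (g.onEnd (e (e.symm a)))) (h v) = h (e (e.symm a) v) at h1
  simpa only [AlgEquiv.apply_symm_apply] using h1

theorem conjHom_surjective : Function.Surjective (conjHom F) := by
  intro g
  obtain ⟨h, hh⟩ := g.exists_onEnd_eq_conj
  have happ (A : WW F) (y : V2 F) : g.1 A (vone F) (h y) = h (A (vone F) y) := by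
    rw [g.apply_vone, hh]
  set u := h.symm (vone F) with hu
  have hhu : h u = vone F := h.apply_symm_apply _
  have key (b : Module.End F (V2 F)) (A : WW F) (y : V2 F) :
      g.1 A (h (b u)) (h y) = h (A (b (vone F)) y) := by
    have h1 := happ (endAct b A) y
    rw [g.map_endAct_onEnd, endAct_apply, endAct_apply, ← hhu, hh, hh, hhu, happ, happ, hh] at h1
    simp only [map_sub] at h1
    linear_combination (norm := module) -h1
  have hu1 : u 1 = 0 := by
    by_contra hne
    have h1 (A : WW F) : A (h (u 1 • vone F)) = 0 := by
      refine LinearMap.ext fun y => ?_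
      have h2 := key ((LinearMap.proj 1).smulRight (vone F)) (g.1.symm A) (h.symm y)
      simpa [vone] using h2
    have h3 : h (u 1 • vone F) = 0 := by
      ext i
      have h4 := LinearMap.congr_fun (h1 ((LinearMap.proj i).smulRight 1)) (vone F)
      simpa [vone] using congrFun h4 0
    rw [map_eq_zero_iff h h.injective, smul_eq_zero, or_iff_right hne] at h3
    simpa [vone] using congrFun h3 0
  have hu0 : u 0 ≠ 0 := by
    intro h0
    have : u = 0 := by
      ext i
      fin_cases i
      exacts [h0, hu1]
    rw [this, map_zero] at hhu
    simpa [vone] using congrFun hhu 0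
  have key' (A : WW F) (x y : V2 F) : g.1 A (h (u 0 • x)) (h y) = h (A x y) := by
    simpa [vone] using key ((LinearMap.proj 0).smulRight x) A y
  let f : V2 F ≃ₗ[F] V2 F := (LinearEquiv.smulOfNeZero F (V2 F) (u 0) hu0).trans h
  have hf (x : V2 F) : f x = h (u 0 • x) := rfl
  have fv : f (vone F) = vone F := by
    have hu' : u 0 • vone F = u := by
      ext i
      fin_cases i <;> simp [vone, hu1]
    rw [hf, hu', hhu]
  refine ⟨⟨f, fv⟩, Subtype.ext (LinearEquiv.ext fun A => ?_)⟩
  refine LinearMap.ext₂ fun x y => ?_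
  change conjWW f A x y = g.1 A x y
  obtain ⟨x, rfl⟩ := f.surjective x
  obtain ⟨y, rfl⟩ := f.surjective y
  rw [conjWW_apply, f.symm_apply_apply, f.symm_apply_apply, hf x, hf y, key', hf, map_smul, map_smul, map_smul]

end

/-- The homomorphism Φ : GL(V₂,v₁) → Aut(W(2)) is bijective. -/
theorem statement11 :
    ∃ Φ : GLv1 F →* AutW F,
      (∀ (f : GLv1 F) (A : WW F) (x y : V2 F),
        ((Φ f).1 A) x y
          = (f : V2 F ≃ₗ[F] V2 F) (A ((f : V2 F ≃ₗ[F] V2 F).symm x)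
              ((f : V2 F ≃ₗ[F] V2 F).symm y))) ∧
      Function.Bijective ⇑Φ := by
  exact ⟨conjHom F, fun _ _ _ _ => rfl, conjHom_injective, conjHom_surjective⟩

end
end

section
/- Every nonzero idempotent e of W(2) (i.e., e·e = e, e ≠ 0) lies in the Aut(W(2))-orbit of one of the following elements: w₁(c) = e₈ + e₂ − e₁ + c(3e₈ + e₅ − 2e₁) for some c ∈ F; w₂(c,d) = −e₁ + c(e₅ − 2e₁) + d·e₈ for some c, d ∈ F; w₃(c,d) = −e₁ − 2e₈ + 4e₃ + e₆ + 3e₇ + c(3e₈ − e₅ + 2e₁) + d·e₄ for some c, d ∈ F; or w₄(c,q) = −e₁ − 2e₈ + c(3e₈ − e₅ + 2e₁) + q·e₄ for some c ∈ F and q ∈ F, q ≠ 0. -/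
noncomputable section

variable (F : Type*) [Field F] [CharZero F]

def w1 (c : F) : WW F :=
  bE F 7 + bE F 1 - bE F 0 + c • ((3 : F) • bE F 7 + bE F 4 - (2 : F) • bE F 0)

def w2 (c d : F) : WW F :=
  -bE F 0 + c • (bE F 4 - (2 : F) • bE F 0) + d • bE F 7

def w3 (c d : F) : WW F :=
  -bE F 0 - (2 : F) • bE F 7 + (4 : F) • bE F 2 + bE F 5 + (3 : F) • bE F 6
    + c • ((3 : F) • bE F 7 - bE F 4 + (2 : F) • bE F 0) + d • bE F 3

def w4 (c q : F) : WW F :=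
  -bE F 0 - (2 : F) • bE F 7 + c • ((3 : F) • bE F 7 - bE F 4 + (2 : F) • bE F 0)
    + q • bE F 3

/-- g is an algebra automorphism of W(2). -/
def IsAut (g : WW F ≃ₗ[F] WW F) : Prop :=
  ∀ A B : WW F, g (wmul F A B) = wmul F (g A) (g B)

/-- y lies in the Aut(W(2))-orbit of x. -/
def InOrbit (x y : WW F) : Prop :=
  ∃ g : WW F ≃ₗ[F] WW F, IsAut F g ∧ g x = y

section Coordinates

variable {K : Type*} [Field K]

/-- A bilinear map on `K²` in coordinates. -/
theorem exists_coords (e : WW K) : ∃ a b c d p q r s : K, ∀ x y : V2 K, e x y =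
    ![a * (x 0 * y 0) + c * (x 0 * y 1) + p * (x 1 * y 0) + r * (x 1 * y 1),
      b * (x 0 * y 0) + d * (x 0 * y 1) + q * (x 1 * y 0) + s * (x 1 * y 1)] := by
  refine ⟨e ![1, 0] ![1, 0] 0, e ![1, 0] ![1, 0] 1, e ![1, 0] ![0, 1] 0, e ![1, 0] ![0, 1] 1,
    e ![0, 1] ![1, 0] 0, e ![0, 1] ![1, 0] 1, e ![0, 1] ![0, 1] 0, e ![0, 1] ![0, 1] 1, ?_⟩
  intro x y
  have decomp (z : V2 K) : z = z 0 • ![1, 0] + z 1 • ![0, 1] := by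
    ext k; fin_cases k <;> simp
  conv_lhs => rw [decomp x, decomp y]
  simp only [map_add, map_smul, LinearMap.add_apply, LinearMap.smul_apply]
  ext k
  fin_cases k <;> simp <;> ring

/-- The linear automorphism of `K²` fixing `v₁` and mapping `v₂` to `t v₁ + m v₂`. -/
def shear (t m : K) (hm : m ≠ 0) : V2 K ≃ₗ[K] V2 K where
  toFun x := ![x 0 + t * x 1, m * x 1]
  invFun x := ![x 0 - t * (m⁻¹ * x 1), m⁻¹ * x 1]
  map_add' x y := by ext k; fin_cases k <;> simp <;> ring
  map_smul' c x := by ext k; fin_cases k <;> simp <;> ring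
  left_inv x := by ext k; fin_cases k <;> simp [hm]
  right_inv x := by ext k; fin_cases k <;> simp [hm]

theorem shear_apply (t m : K) (hm : m ≠ 0) (x : V2 K) :
    shear t m hm x = ![x 0 + t * x 1, m * x 1] := rfl

theorem inOrbit_of_intertwines (G : V2 K ≃ₗ[K] V2 K) (hG : G (vone K) = vone K) (w e : WW K)
    (h : ∀ x y, G (w x y) = e (G x) (G y)) : InOrbit K w e := by
  have hG' : G.symm (vone K) = vone K := by rw [LinearEquiv.symm_apply_eq, hG]
  refine ⟨G.arrowCongr (G.arrowCongr G), fun A B => ?_, ?_⟩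
  · refine LinearMap.ext fun x => LinearMap.ext fun y => ?_
    simp [wmul, LinearEquiv.arrowCongr_apply, hG']
  · refine LinearMap.ext fun x => LinearMap.ext fun y => ?_
    simp [LinearEquiv.arrowCongr_apply, h]

theorem inOrbit_of_shear (t m : K) (hm : m ≠ 0) (w e : WW K)
    (h : ∀ x y, shear t m hm (w x y) = e (shear t m hm x) (shear t m hm y)) : InOrbit K w e :=
  inOrbit_of_intertwines (shear t m hm)
    (by ext k; fin_cases k <;> simp [shear_apply, vone]) w e h

theorem w1_apply (c : K) (x y : V2 K) : w1 K c x y =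
    ![-(x 0 * y 0), x 0 * y 0 + (2 + 6 * c) * (x 0 * y 1)] := by
  ext k
  fin_cases k <;> simp [w1, bE, alphaM] <;> ring

theorem w2_apply (c d : K) (x y : V2 K) : w2 K c d x y =
    ![-(x 0 * y 0), (1 + 3 * c + d) * (x 0 * y 1) + (1 + 3 * c - d) * (x 1 * y 0)] := by
  ext k
  fin_cases k <;> simp [w2, bE, alphaM] <;> ring

theorem w3_apply (c d : K) (x y : V2 K) : w3 K c d x y =
    ![-(x 0 * y 0) - 6 * (x 1 * y 0) + d * (x 1 * y 1),
      -(x 0 * y 1) + (3 - 6 * c) * (x 1 * y 0) + 6 * (x 1 * y 1)] := by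
  ext k
  fin_cases k <;> simp [w3, bE, alphaM] <;> ring

theorem w4_apply (c q : K) (x y : V2 K) : w4 K c q x y =
    ![-(x 0 * y 0) + q * (x 1 * y 1), -(x 0 * y 1) + (3 - 6 * c) * (x 1 * y 0)] := by
  ext k
  fin_cases k <;> simp [w4, bE, alphaM] <;> ring

end Coordinates

/-- Every nonzero idempotent of W(2) lies in the orbit of some w₁(c), w₂(c,d),
w₃(c,d) or w₄(c,q) with q ≠ 0. -/
theorem statement16 (e : WW F) (hid : wmul F e e = e) (h0 : e ≠ 0) :
    (∃ c : F, InOrbit F (w1 F c) e) ∨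
    (∃ c d : F, InOrbit F (w2 F c d) e) ∨
    (∃ c d : F, InOrbit F (w3 F c d) e) ∨
    (∃ c q : F, q ≠ 0 ∧ InOrbit F (w4 F c q) e) := by
  obtain ⟨a, b, c, d, p, q, r, s, he⟩ := exists_coords e
  have h6 : (6 : F) ≠ 0 := by norm_num
  have eqn (x y : V2 F) (k : Fin 2) : wmul F e e x y k = e x y k := by rw [hid]
  have e11 := eqn ![1, 0] ![1, 0]
  have e12 := eqn ![1, 0] ![0, 1]
  have e21 := eqn ![0, 1] ![1, 0]
  have e22 := eqn ![0, 1] ![0, 1]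
  simp only [wmul, LinearMap.mk₂_apply, he, vone, Fin.forall_fin_two, Pi.sub_apply,
    Matrix.cons_val_zero, Matrix.cons_val_one, mul_one, mul_zero, zero_mul, one_mul, add_zero,
    zero_add] at e11 e12 e21 e22
  obtain ⟨e110, e111⟩ := e11
  obtain ⟨e120, e121⟩ := e12
  obtain ⟨e210, e211⟩ := e21
  obtain ⟨e220, e221⟩ := e22
  by_cases hb : b = 0
  · subst hb
    have ha : a * (a + 1) = 0 := by linear_combination -e110
    rcases mul_eq_zero.mp ha with ha | ha
    · subst ha
      have hc : c = 0 := by linear_combination -e120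
      have hd : d = 0 := by linear_combination -e121
      subst hc hd
      have hp : p = 0 := by linear_combination -e210
      have hq : q = 0 := by linear_combination -e211
      have hr : r = 0 := by linear_combination -e220
      have hs : s = 0 := by linear_combination -e221
      subst hp hq hr hs
      refine absurd (LinearMap.ext fun x => LinearMap.ext fun y => ?_) h0
      rw [he]
      ext k
      fin_cases k <;> simp
    · obtain rfl : a = -1 := by linear_combination ha
      by_cases hd : d = -1
      · subst hd
        have hc : c = 0 := by
          have h1 : c * (q + 1) = 0 := by linear_combination e210
          have h2 : c * (q - 1) = 0 := by linear_combination -e221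
          linear_combination (h1 - h2) / 2
        subst hc
        obtain ⟨τ, rfl⟩ : ∃ τ, s = 2 * τ - p := ⟨(p + s) / 2, by ring⟩
        obtain ⟨p', rfl⟩ : ∃ p', p = p' + τ * (q + 1) := ⟨p - τ * (q + 1), by ring⟩
        obtain ⟨r', rfl⟩ : ∃ r', r = r' - 2 * τ * p' - τ ^ 2 * q :=
          ⟨r + 2 * τ * p' + τ ^ 2 * q, by ring⟩
        by_cases hp0 : p' = 0
        · subst hp0
          by_cases hr0 : r' = 0
          · subst hr0
            refine Or.inr (Or.inl ⟨(q - 3) / 6, (-1 - q) / 2,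
              inOrbit_of_shear τ 1 one_ne_zero _ _ fun x y => ?_⟩)
            ext k
            fin_cases k
            · simp [shear_apply, w2_apply, he]
              ring
            · simp [shear_apply, w2_apply, he]
              ring
          · refine Or.inr (Or.inr (Or.inr ⟨(3 - q) / 6, r', hr0,
              inOrbit_of_shear τ 1 one_ne_zero _ _ fun x y => ?_⟩))
            ext k
            fin_cases k
            · simp [shear_apply, w4_apply, he]
              ring
            · simp [shear_apply, w4_apply, he]
              ring
        · have hm : -6 / p' ≠ 0 := div_ne_zero (neg_ne_zero.mpr h6) hp0
          set m : F := -6 / p' with hm_def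
          have hmp : m * p' = -6 := by rw [hm_def]; field_simp
          clear_value m
          refine Or.inr (Or.inr (Or.inl ⟨(3 - q) / 6, m ^ 2 * r',
              inOrbit_of_shear (m * τ) m hm _ _ fun x y => ?_⟩))
          ext k
          fin_cases k
          · simp [shear_apply, w3_apply, he]
            linear_combination (x 1 * y 1 * m * τ - x 1 * y 0) * hmp
          · simp [shear_apply, w3_apply, he]
            linear_combination (x 1 * y 1 * m) * hmp
      · have hd' : d + 1 ≠ 0 := fun h => hd (by linear_combination h)
        set t : F := c / (d + 1) with ht
        have hc : c = t * (d + 1) := by rw [ht]; field_simp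
        clear_value t
        subst hc
        have hp : p = t * (q + 1) := mul_left_cancel₀ hd' (by linear_combination -e210)
        have hs : s = -(t * (d + q)) := mul_left_cancel₀ hd' (by linear_combination -e221)
        have hr : r = t * (s - t * (d + 1) - p) / 2 :=
          mul_left_cancel₀ hd' (by linear_combination -e220 / 2)
        subst hp hs hr
        refine Or.inr (Or.inl ⟨(d + q - 2) / 6, (d - q) / 2,
          inOrbit_of_shear t 1 one_ne_zero _ _ fun x y => ?_⟩)
        ext k
        fin_cases k
        · simp [shear_apply, w2_apply, he]
          ring
        · simp [shear_apply, w2_apply, he]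
          ring
  · have hp : (a + 1) * a + b * p = 0 := by linear_combination -e110
    have hq : q = -(a + 1) := mul_left_cancel₀ hb (by linear_combination -e111)
    subst hq
    have hr : (a + 1) * c + b * r = 0 := by linear_combination -e120
    have hs : (a + 1) * d + b * s = 0 := by linear_combination -e121
    have hc : b * c = (a + 1) * (1 + d) := by linear_combination -e211 + hp - hs
    obtain rfl : p = -((a + 1) * a) / b := by field_simp; linear_combination hp
    obtain rfl : c = (a + 1) * (1 + d) / b := by field_simp; linear_combination hc
    obtain rfl : r = -((a + 1) * ((a + 1) * (1 + d) / b)) / b := by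
      rw [eq_div_iff hb]; linear_combination hr
    obtain rfl : s = -((a + 1) * d) / b := by field_simp; linear_combination hs
    refine Or.inl ⟨(a + d - 1) / 6, inOrbit_of_shear (a + 1) b hb _ _ fun x y => ?_⟩
    ext k
    fin_cases k
    · simp [shear_apply, w1_apply, he]
      field_simp
      ring
    · simp [shear_apply, w1_apply, he]
      field_simp
      ring

end
end
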